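/- arXiv:1212.1004 — 2 statements merged into one kernel-verified Lean document; each statement's English description precedes it below -/
import Mathlib

section
/- Let λ > 0 and set α_n = (2 log n)^{-1/2} and β_n = (2 log n)^{1/2} - (log log n + log π) / (2 (2 log n)^{1/2}). Then for every real x, ((F_λ(α_n x + β_n))^n - Λ(x)) · 16 log n / (log log n)² → Λ(x) e^{-x} as n → ∞. -/
open Real MeasureTheory Filter Topology

/-- Standard normal density. -/
noncomputable def stdPhi (x : ℝ) : ℝ := (Real.sqrt (2 * Real.pi))⁻¹ * Real.exp (-(x ^ 2) / 2)

/-- Standard normal cdf. -/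
noncomputable def stdCdf (x : ℝ) : ℝ := ∫ t in Set.Iic x, stdPhi t

/-- Skew normal density with shape parameter l. -/
noncomputable def snPdf (l x : ℝ) : ℝ := 2 * stdPhi x * stdCdf (l * x)

/-- Skew normal cdf with shape parameter l. -/
noncomputable def snCdf (l x : ℝ) : ℝ := ∫ t in Set.Iic x, snPdf l t

/-- Gumbel extreme value distribution function. -/
noncomputable def gumbel (x : ℝ) : ℝ := Real.exp (-Real.exp (-x))


lemma stdPhi_pos (x : ℝ) : 0 < stdPhi x := by unfold stdPhi; positivity

lemma stdPhi_eq (x : ℝ) : stdPhi x = (Real.sqrt (2 * Real.pi))⁻¹ * Real.exp (-(1/2) * x ^ 2) := by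
  unfold stdPhi; congr 2; ring

lemma stdPhi_integrable : Integrable stdPhi := by
  have := (integrable_exp_neg_mul_sq (b := 1/2) (by norm_num)).const_mul (Real.sqrt (2 * Real.pi))⁻¹
  refine this.congr (Eventually.of_forall fun x => ?_)
  exact (stdPhi_eq x).symm

lemma stdPhi_integral : ∫ x, stdPhi x = 1 := by
  simp_rw [stdPhi_eq]
  rw [integral_const_mul, integral_gaussian]
  have : Real.pi / (1/2) = 2 * Real.pi := by ring
  rw [this]
  exact inv_mul_cancel₀ (by positivity)

lemma stdPhi_neg (x : ℝ) : stdPhi (-x) = stdPhi x := by unfold stdPhi; simp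

lemma stdPhi_hasDerivAt (x : ℝ) : HasDerivAt stdPhi (-(x * stdPhi x)) x := by
  have h : HasDerivAt (fun x : ℝ => -(x ^ 2) / 2) (-x) x := by
    have := ((hasDerivAt_pow 2 x).neg).div_const 2
    exact this.congr_deriv (by push_cast; ring)
  have := (h.exp).const_mul (Real.sqrt (2 * Real.pi))⁻¹
  exact this.congr_deriv (by unfold stdPhi; ring)

lemma stdPhi_tendsto : Tendsto stdPhi atTop (𝓝 0) := by
  have h : Tendsto (fun x : ℝ => -(x ^ 2) / 2) atTop atBot := by
    have : Tendsto (fun x : ℝ => (1/2) * x ^ 2) atTop atTop :=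
      (tendsto_pow_atTop two_ne_zero).const_mul_atTop (by norm_num)
    have h2 := tendsto_neg_atTop_atBot.comp this
    refine h2.congr fun x => ?_
    simp; ring
  have := (tendsto_exp_atBot.comp h).const_mul (Real.sqrt (2 * Real.pi))⁻¹
  rw [mul_zero] at this
  exact this

lemma stdCdf_nonneg (x : ℝ) : 0 ≤ stdCdf x :=
  integral_nonneg fun t => (stdPhi_pos t).le

lemma stdCdf_mono : Monotone stdCdf := fun _ _ h =>
  setIntegral_mono_set stdPhi_integrable.integrableOn
    (Eventually.of_forall fun t => (stdPhi_pos t).le)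
    (Set.Iic_subset_Iic.2 h).eventuallyLE

lemma stdCdf_add_tail (x : ℝ) : stdCdf x + ∫ t in Set.Ioi x, stdPhi t = 1 := by
  have := integral_add_compl (measurableSet_Iic (a := x)) stdPhi_integrable
  rw [stdPhi_integral, Set.compl_Iic] at this
  exact this

lemma tail_nonneg (x : ℝ) : 0 ≤ ∫ t in Set.Ioi x, stdPhi t :=
  integral_nonneg fun t => (stdPhi_pos t).le

lemma stdCdf_le_one (x : ℝ) : stdCdf x ≤ 1 := by
  linarith [stdCdf_add_tail x, tail_nonneg x]

lemma stdCdf_neg (x : ℝ) : stdCdf x + stdCdf (-x) = 1 := by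
  rw [← stdCdf_add_tail x]
  congr 1
  have := integral_comp_neg_Iic (-x) stdPhi
  simp_rw [stdPhi_neg, neg_neg] at this
  exact this

lemma snPdf_integrable (l : ℝ) : Integrable (snPdf l) := by
  have hm : AEStronglyMeasurable (fun x => stdCdf (l * x)) volume :=
    (stdCdf_mono.measurable.comp (measurable_const_mul l)).aestronglyMeasurable
  have h := (stdPhi_integrable.const_mul 2).mul_bdd (c := 1) hm
    (Eventually.of_forall fun x => by
      rw [Real.norm_eq_abs, abs_of_nonneg (stdCdf_nonneg _)]; exact stdCdf_le_one _)
  exact h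

lemma snPdf_integral (l : ℝ) : ∫ x, snPdf l x = 1 := by
  have h1 : ∫ x, snPdf l (-x) = ∫ x, snPdf l x := integral_neg_eq_self (snPdf l) volume
  have h2 : ∫ x, (snPdf l x + snPdf l (-x)) = 2 := by
    have : ∀ x, snPdf l x + snPdf l (-x) = 2 * stdPhi x := by
      intro x
      unfold snPdf
      rw [stdPhi_neg, mul_neg, ← mul_add, stdCdf_neg, mul_one]
    simp_rw [this]
    rw [integral_const_mul, stdPhi_integral, mul_one]
  rw [integral_add (snPdf_integrable l) (snPdf_integrable l).comp_neg, h1] at h2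
  linarith

lemma snCdf_eq (l x : ℝ) : snCdf l x = 1 - ∫ t in Set.Ioi x, snPdf l t := by
  have := integral_add_compl (measurableSet_Iic (a := x)) (snPdf_integrable l)
  rw [snPdf_integral, Set.compl_Iic] at this
  unfold snCdf
  linarith

lemma tail_upper {z : ℝ} (hz : 0 < z) : ∫ t in Set.Ioi z, stdPhi t ≤ stdPhi z / z := by
  have hd : ∀ t ∈ Set.Ici z, HasDerivAt (fun t => -(stdPhi t / z)) (t / z * stdPhi t) t := by
    intro t _
    have := ((stdPhi_hasDerivAt t).div_const z).neg
    exact this.congr_deriv (by field_simp)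
  have hpos : ∀ t ∈ Set.Ioi z, 0 ≤ t / z * stdPhi t := fun t ht => by
    have : 0 < t := hz.trans ht
    have := stdPhi_pos t
    positivity
  have hlim : Tendsto (fun t => -(stdPhi t / z)) atTop (𝓝 0) := by
    simpa using (stdPhi_tendsto.div_const z).neg
  have hint := integrableOn_Ioi_deriv_of_nonneg' hd hpos hlim
  have hv := integral_Ioi_of_hasDerivAt_of_nonneg' hd hpos hlim
  have : ∫ t in Set.Ioi z, stdPhi t ≤ ∫ t in Set.Ioi z, t / z * stdPhi t := by
    refine setIntegral_mono_on stdPhi_integrable.integrableOn hint measurableSet_Ioi fun t ht => ?_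
    have h1 : 1 ≤ t / z := (one_le_div hz).2 (le_of_lt ht)
    nlinarith [stdPhi_pos t]
  rw [hv] at this
  simpa using this

lemma tail_lower {z : ℝ} (hz : 1 ≤ z) :
    stdPhi z / z * (1 - 1 / z ^ 2) ≤ ∫ t in Set.Ioi z, stdPhi t := by
  have hd : ∀ t ∈ Set.Ici z, HasDerivAt (fun t => -(stdPhi t * (t / (1 + t ^ 2))))
      (stdPhi t * ((t ^ 4 + 2 * t ^ 2 - 1) / (1 + t ^ 2) ^ 2)) t := by
    intro t _
    have h0 : (1 + t ^ 2 : ℝ) ≠ 0 := by positivity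
    have h1 : HasDerivAt (fun t : ℝ => 1 + t ^ 2) (2 * t) t := by
      simpa using (hasDerivAt_pow 2 t).const_add 1
    have := ((stdPhi_hasDerivAt t).mul ((hasDerivAt_id t).div h1 h0)).neg
    refine this.congr_deriv ?_
    simp only [id, Pi.div_apply]
    field_simp
    ring
  have hpos : ∀ t ∈ Set.Ioi z, 0 ≤ stdPhi t * ((t ^ 4 + 2 * t ^ 2 - 1) / (1 + t ^ 2) ^ 2) :=
    fun t ht => by
    have h1 : 1 < t := hz.trans_lt ht
    have := stdPhi_pos t
    have h2 : 0 ≤ t ^ 4 + 2 * t ^ 2 - 1 := by nlinarith [sq_nonneg (t^2)]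
    positivity
  have hlim : Tendsto (fun t => -(stdPhi t * (t / (1 + t ^ 2)))) atTop (𝓝 0) := by
    rw [← neg_zero]
    refine Tendsto.neg ?_
    refine squeeze_zero' ?_ ?_ stdPhi_tendsto
    · filter_upwards [eventually_ge_atTop 0] with t ht
      have := stdPhi_pos t
      positivity
    · filter_upwards [eventually_ge_atTop 0] with t ht
      have h1 : t / (1 + t ^ 2) ≤ 1 := by
        rw [div_le_one (by positivity)]; nlinarith [sq_nonneg (t - 1)]
      nlinarith [stdPhi_pos t]
  have hint := integrableOn_Ioi_deriv_of_nonneg' hd hpos hlim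
  have hv := integral_Ioi_of_hasDerivAt_of_nonneg' hd hpos hlim
  have : ∫ t in Set.Ioi z, stdPhi t * ((t ^ 4 + 2 * t ^ 2 - 1) / (1 + t ^ 2) ^ 2)
      ≤ ∫ t in Set.Ioi z, stdPhi t := by
    refine setIntegral_mono_on hint stdPhi_integrable.integrableOn measurableSet_Ioi fun t ht => ?_
    have h1 : (t ^ 4 + 2 * t ^ 2 - 1) / (1 + t ^ 2) ^ 2 ≤ 1 := by
      rw [div_le_one (by positivity)]; nlinarith
    nlinarith [stdPhi_pos t]
  rw [hv] at this
  refine le_trans ?_ this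
  have hz0 : 0 < z := by linarith
  have h3 : 1 / z * (1 - 1 / z ^ 2) ≤ z / (1 + z ^ 2) := by
    rw [← sub_nonneg]
    have : z / (1 + z ^ 2) - 1 / z * (1 - 1 / z ^ 2) = 1 / (z ^ 3 * (1 + z ^ 2)) := by
      field_simp; ring
    rw [this]; positivity
  calc stdPhi z / z * (1 - 1 / z ^ 2) = stdPhi z * (1 / z * (1 - 1 / z ^ 2)) := by ring
    _ ≤ stdPhi z * (z / (1 + z ^ 2)) := by gcongr; exact (stdPhi_pos z).le
    _ = _ := by ring

lemma stdCdf_lower {w : ℝ} (hw : 0 < w) : 1 - 1 / w ^ 2 ≤ stdCdf w := by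
  have h1 := tail_upper hw
  have h2 := stdCdf_add_tail w
  have h3 : stdPhi w ≤ 1 / w := by
    unfold stdPhi
    have ha : (Real.sqrt (2 * Real.pi))⁻¹ ≤ 1 := by
      apply inv_le_one_of_one_le₀
      rw [Real.one_le_sqrt]
      nlinarith [Real.pi_gt_three]
    have hb : Real.exp (-(w ^ 2) / 2) ≤ 1 / w := by
      rw [neg_div, Real.exp_neg, ← one_div]
      apply one_div_le_one_div_of_le hw
      have := Real.add_one_le_exp (w ^ 2 / 2)
      nlinarith [sq_nonneg (w - 1)]
    calc _ ≤ 1 * Real.exp (-(w ^ 2) / 2) := by gcongr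
      _ ≤ _ := by rw [one_mul]; exact hb
  have h4 : stdPhi w / w ≤ 1 / w ^ 2 := by
    calc stdPhi w / w ≤ (1 / w) / w := by gcongr
      _ = _ := by field_simp
  linarith

/-- Two sided bound on the skew normal tail. -/
lemma sn_tail {l : ℝ} (hl : 0 < l) {z : ℝ} (hz : 1 ≤ z) :
    2 * stdPhi z / z * (1 - (1 + 1 / l ^ 2) / z ^ 2) ≤ 1 - snCdf l z ∧
      1 - snCdf l z ≤ 2 * stdPhi z / z := by
  have hz0 : 0 < z := by linarith
  have hp := stdPhi_pos z
  rw [snCdf_eq, sub_sub_cancel]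
  constructor
  · have h1 : ∫ t in Set.Ioi z, 2 * stdCdf (l * z) * stdPhi t ≤ ∫ t in Set.Ioi z, snPdf l t := by
      refine setIntegral_mono_on (stdPhi_integrable.const_mul _).integrableOn
        (snPdf_integrable l).integrableOn measurableSet_Ioi fun t ht => ?_
      have : stdCdf (l * z) ≤ stdCdf (l * t) :=
        stdCdf_mono (mul_le_mul_of_nonneg_left (le_of_lt ht) hl.le)
      unfold snPdf
      nlinarith [stdPhi_pos t]
    rw [integral_const_mul] at h1
    refine le_trans ?_ h1
    have h2 := tail_lower hz
    have h3 := stdCdf_lower (mul_pos hl hz0)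
    set T := ∫ t in Set.Ioi z, stdPhi t
    set S := stdCdf (l * z)
    have hS : 0 ≤ S := stdCdf_nonneg _
    have hS1 : S ≤ 1 := stdCdf_le_one _
    have h4 : 1 - (1 + 1 / l ^ 2) / z ^ 2 ≤ S * (1 - 1 / z ^ 2) := by
      have e1 : (1 + 1 / l ^ 2) / z ^ 2 = 1 / z ^ 2 + 1 / (l * z) ^ 2 := by field_simp
      rw [e1]
      have : 0 < 1 / z ^ 2 := by positivity
      nlinarith
    calc 2 * stdPhi z / z * (1 - (1 + 1 / l ^ 2) / z ^ 2)
        ≤ 2 * stdPhi z / z * (S * (1 - 1 / z ^ 2)) := by gcongr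
      _ = 2 * S * (stdPhi z / z * (1 - 1 / z ^ 2)) := by ring
      _ ≤ 2 * S * T := by gcongr
  · have h1 : ∫ t in Set.Ioi z, snPdf l t ≤ ∫ t in Set.Ioi z, 2 * stdPhi t := by
      refine setIntegral_mono_on (snPdf_integrable l).integrableOn
        (stdPhi_integrable.const_mul _).integrableOn measurableSet_Ioi fun t ht => ?_
      unfold snPdf
      nlinarith [stdPhi_pos t, stdCdf_le_one (l * t)]
    rw [integral_const_mul] at h1
    have := tail_upper hz0
    calc _ ≤ _ := h1
      _ ≤ 2 * (stdPhi z / z) := by gcongr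
      _ = _ := by ring

lemma exp_rate {d r : ℕ → ℝ} {κ : ℝ} (hr : Tendsto r atTop (𝓝 0)) (hr0 : ∀ᶠ n in atTop, 0 < r n)
    (h : Tendsto (fun n => d n / r n) atTop (𝓝 κ)) :
    Tendsto (fun n => (Real.exp (d n) - 1) / r n) atTop (𝓝 κ) := by
  have hd : Tendsto d atTop (𝓝 0) := by
    have := h.mul hr
    rw [mul_zero] at this
    refine this.congr' ?_
    filter_upwards [hr0] with n hn
    field_simp
  have hq : Tendsto (fun n => (Real.exp (d n) - 1 - d n) / r n) atTop (𝓝 0) := by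
    have hb : Tendsto (fun n => |d n / r n| * |d n|) atTop (𝓝 0) := by
      have := h.abs.mul hd.abs
      simpa using this
    refine squeeze_zero_norm' ?_ hb
    have hd1 : ∀ᶠ n in atTop, |d n| < 1 := by
      have := hd.abs
      rw [abs_zero] at this
      exact this.eventually_lt_const one_pos
    filter_upwards [hd1, hr0] with n h1 h2
    have := Real.abs_exp_sub_one_sub_id_le h1.le
    rw [Real.norm_eq_abs, abs_div, abs_div, abs_of_pos h2, div_mul_eq_mul_div]
    gcongr
    rw [← sq, sq_abs]; exact this
  have := h.add hq
  rw [add_zero] at this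
  refine this.congr fun n => ?_
  ring

lemma mul_rate {A B r : ℕ → ℝ} {a b : ℝ} (hr : Tendsto r atTop (𝓝 0))
    (hr0 : ∀ᶠ n in atTop, 0 < r n)
    (hA : Tendsto (fun n => (1 - A n) / r n) atTop (𝓝 a))
    (hB : Tendsto (fun n => (1 - B n) / r n) atTop (𝓝 b)) :
    Tendsto (fun n => (1 - A n * B n) / r n) atTop (𝓝 (a + b)) := by
  have hA1 : Tendsto A atTop (𝓝 1) := by
    have := (hA.mul hr).const_sub 1
    rw [mul_zero, sub_zero] at this
    refine this.congr' ?_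
    filter_upwards [hr0] with n hn
    field_simp; ring
  have := hA.add (hA1.mul hB)
  rw [one_mul] at this
  refine this.congr fun n => ?_
  ring

lemma dens_identity {L x a c : ℝ} (hL : 0 < L) (ha : a = Real.sqrt (2 * L))
    (hc : c = x - (Real.log L + Real.log Real.pi) / 2) (hu : 0 < 1 + c / (2 * L)) :
    2 * stdPhi (a * (1 + c / (2 * L))) / (a * (1 + c / (2 * L))) =
      Real.exp (-L) * (Real.exp (-x) * ((1 + c / (2 * L))⁻¹ * Real.exp (-(c ^ 2 / (4 * L))))) := by
  have ha0 : 0 < a := by rw [ha]; positivity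
  have ha2 : a ^ 2 = 2 * L := by rw [ha]; exact Real.sq_sqrt (by positivity)
  have hz : -((a * (1 + c / (2 * L))) ^ 2) / 2 = -L + -x +
      (Real.log L + Real.log Real.pi) / 2 + -(c ^ 2 / (4 * L)) := by
    have h1 : (Real.log L + Real.log Real.pi) / 2 = x - c := by rw [hc]; ring
    rw [h1, mul_pow, ha2]; field_simp; ring
  have he : Real.exp ((Real.log L + Real.log Real.pi) / 2) = Real.sqrt (L * Real.pi) := by
    rw [← Real.log_mul hL.ne' Real.pi_ne_zero, Real.exp_half, Real.exp_log (by positivity)]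
  have hs : 2 * Real.sqrt (L * Real.pi) = a * Real.sqrt (2 * Real.pi) := by
    rw [ha, ← Real.sqrt_mul (by positivity)]
    have : 2 * L * (2 * Real.pi) = 2 ^ 2 * (L * Real.pi) := by ring
    rw [this, Real.sqrt_mul (by positivity : (0:ℝ) ≤ 2 ^ 2) (L * Real.pi), Real.sqrt_sq (by norm_num)]
  have hsp : 0 < Real.sqrt (2 * Real.pi) := by positivity
  unfold stdPhi
  rw [hz, Real.exp_add, Real.exp_add, Real.exp_add, he]
  set v := 1 + c / (2 * L)
  calc _ = (2 * Real.sqrt (L * Real.pi)) * (Real.exp (-L) * Real.exp (-x) *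
        Real.exp (-(c ^ 2 / (4 * L)))) / (Real.sqrt (2 * Real.pi) * a * v) := by
        field_simp
    _ = _ := by rw [hs]; field_simp

theorem skew_normal_rate_pos (l : ℝ) (hl : 0 < l) (x : ℝ) :
    Tendsto (fun n : ℕ =>
      ((snCdf l ((Real.sqrt (2 * Real.log n))⁻¹ * x +
        (Real.sqrt (2 * Real.log n) -
          (Real.log (Real.log n) + Real.log Real.pi) /
            (2 * Real.sqrt (2 * Real.log n))))) ^ n - gumbel x) *
        (16 * Real.log n) / (Real.log (Real.log n)) ^ 2) atTop
      (𝓝 (gumbel x * Real.exp (-x))) := by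
  have hNat : Tendsto (fun n : ℕ => (n : ℝ)) atTop atTop := tendsto_natCast_atTop_atTop
  set L : ℕ → ℝ := fun n => Real.log n with hLdef
  have hL : Tendsto L atTop atTop := Real.tendsto_log_atTop.comp hNat
  set y : ℕ → ℝ := fun n => Real.log (L n) with hydef
  have hy : Tendsto y atTop atTop := Real.tendsto_log_atTop.comp hL
  have hL0 : ∀ᶠ n in atTop, 0 < L n := hL.eventually_gt_atTop 0
  have hy0 : ∀ᶠ n in atTop, 0 < y n := hy.eventually_gt_atTop 0
  have hyi : Tendsto (fun n => (y n)⁻¹) atTop (𝓝 0) := tendsto_inv_atTop_zero.comp hy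
  have hyL : Tendsto (fun n => y n / L n) atTop (𝓝 0) :=
    (Real.isLittleO_log_id_atTop.tendsto_div_nhds_zero).comp hL
  have hy2L : Tendsto (fun n => y n ^ 2 / L n) atTop (𝓝 0) :=
    ((Real.isLittleO_pow_log_id_atTop (n := 2)).tendsto_div_nhds_zero).comp hL
  have hLn : Tendsto (fun n : ℕ => L n / (n : ℝ)) atTop (𝓝 0) :=
    (Real.isLittleO_log_id_atTop.tendsto_div_nhds_zero).comp hNat
  set r : ℕ → ℝ := fun n => y n ^ 2 / (16 * L n) with hrdef
  have hr : Tendsto r atTop (𝓝 0) := by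
    have := hy2L.div_const 16
    rw [zero_div] at this
    refine this.congr fun n => ?_
    simp only [hrdef]; rw [div_div, mul_comm]
  have hr0 : ∀ᶠ n in atTop, 0 < r n := by
    filter_upwards [hL0, hy0] with n h1 h2
    simp only [hrdef]; positivity
  set c : ℕ → ℝ := fun n => x - (y n + Real.log Real.pi) / 2 with hcdef
  have hcy : Tendsto (fun n => c n / y n) atTop (𝓝 (-(1/2))) := by
    have := (hyi.const_mul (x - Real.log Real.pi / 2)).sub_const (1/2)
    rw [mul_zero, zero_sub] at this
    refine this.congr' ?_
    filter_upwards [hy0] with n h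
    simp only [hcdef]; field_simp; ring
  set u : ℕ → ℝ := fun n => c n / (2 * L n) with hudef
  have hu : Tendsto u atTop (𝓝 0) := by
    have := (hcy.mul hyL).div_const 2
    rw [mul_zero, zero_div] at this
    refine this.congr' ?_
    filter_upwards [hL0, hy0] with n h1 h2
    simp only [hudef]; field_simp
  have hu1 : Tendsto (fun n => 1 + u n) atTop (𝓝 1) := by simpa using hu.const_add 1
  have hu0 : ∀ᶠ n in atTop, 0 < 1 + u n := hu1.eventually_const_lt one_pos
  -- first factor
  have hA : Tendsto (fun n => (1 - (1 + u n)⁻¹) / r n) atTop (𝓝 0) := by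
    have := ((hcy.mul hyi).mul (hu1.inv₀ one_ne_zero)).const_mul 8
    rw [mul_zero, zero_mul, mul_zero] at this
    refine this.congr' ?_
    filter_upwards [hL0, hy0, hu0] with n h1 h2 h3
    have e1 : 1 - (1 + u n)⁻¹ = u n * (1 + u n)⁻¹ := by field_simp; ring
    rw [e1]
    generalize (1 + u n)⁻¹ = q
    simp only [hudef, hrdef]
    field_simp
    try ring
  -- second factor
  have hB : Tendsto (fun n => (1 - Real.exp (-(c n ^ 2 / (4 * L n)))) / r n) atTop (𝓝 1) := by
    have h1 : Tendsto (fun n => -(c n ^ 2 / (4 * L n)) / r n) atTop (𝓝 (-1)) := by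
      have := (hcy.pow 2).const_mul (-4)
      have e : (-4 : ℝ) * (-(1/2)) ^ 2 = -1 := by norm_num
      rw [e] at this
      refine this.congr' ?_
      filter_upwards [hL0, hy0] with n h1 h2
      simp only [hrdef]
      field_simp
      try ring
    have := (exp_rate hr hr0 h1).neg
    rw [neg_neg] at this
    refine this.congr fun n => ?_
    ring
  set a : ℕ → ℝ := fun n => Real.sqrt (2 * L n) with hadef
  have ha : Tendsto a atTop atTop :=
    Real.tendsto_sqrt_atTop.comp (hL.const_mul_atTop two_pos)
  set z : ℕ → ℝ := fun n => a n * (1 + u n) with hzdef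
  have hz : Tendsto z atTop atTop := ha.atTop_mul_pos one_pos hu1
  have hz1 : ∀ᶠ n in atTop, 1 ≤ z n := hz.eventually_ge_atTop 1
  have hzr : Tendsto (fun n => 1 / z n ^ 2 / r n) atTop (𝓝 0) := by
    have := (((hu1.inv₀ one_ne_zero).pow 2).mul (hyi.pow 2)).const_mul 8
    rw [zero_pow two_ne_zero, mul_zero, mul_zero] at this
    refine this.congr' ?_
    filter_upwards [hL0, hy0, hu0] with n h1 h2 h3
    have ha2 : a n ^ 2 = 2 * L n := Real.sq_sqrt (by positivity)
    simp only [hzdef, hrdef]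
    rw [mul_pow, ha2]
    field_simp
    try ring
  set p : ℕ → ℝ := fun n => 1 - snCdf l (z n) with hpdef
  set g : ℕ → ℝ := fun n => 2 * stdPhi (z n) / z n with hgdef
  set θ : ℕ → ℝ := fun n => p n / g n with hθdef
  have hg0 : ∀ᶠ n in atTop, 0 < g n := by
    filter_upwards [hz1] with n h1
    have := stdPhi_pos (z n)
    simp only [hgdef]; positivity
  have hT : Tendsto (fun n => (1 - θ n) / r n) atTop (𝓝 0) := by
    have := hzr.const_mul (1 + 1 / l ^ 2)
    rw [mul_zero] at this
    refine squeeze_zero' ?_ ?_ this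
    · filter_upwards [hz1, hg0, hr0] with n h1 h2 h3
      have := (sn_tail hl h1).2
      have h4 : θ n ≤ 1 := (div_le_one h2).2 this
      exact div_nonneg (by linarith) h3.le
    · filter_upwards [hz1, hg0, hr0] with n h1 h2 h3
      have := (sn_tail hl h1).1
      have h4 : 1 - (1 + 1 / l ^ 2) / z n ^ 2 ≤ θ n := by
        rw [hθdef, le_div_iff₀ h2, mul_comm]; exact this
      rw [← mul_div_assoc]
      gcongr
      rw [mul_one_div]
      linarith
  have hW := mul_rate hr hr0 (mul_rate hr hr0 hA hB) hT
  rw [zero_add, add_zero] at hW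
  set W : ℕ → ℝ := fun n => (1 + u n)⁻¹ * Real.exp (-(c n ^ 2 / (4 * L n))) * θ n with hWdef
  have hW1 : Tendsto W atTop (𝓝 1) := by
    have := (hW.mul hr).const_sub 1
    rw [mul_zero, sub_zero] at this
    refine this.congr' ?_
    filter_upwards [hr0] with n hn
    have : (1 - W n) / r n * r n = 1 - W n := by field_simp
    change 1 - (1 - W n) / r n * r n = W n
    rw [this]; ring
  set e : ℝ := Real.exp (-x) with hedef
  have hn0 : ∀ᶠ n : ℕ in atTop, 0 < (n : ℝ) := hNat.eventually_gt_atTop 0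
  have hp : ∀ᶠ n : ℕ in atTop, n * p n = e * W n := by
    filter_upwards [hL0, hu0, hg0, hn0] with n h1 h2 h3 h4
    have e1 : p n = g n * θ n := by simp only [hθdef]; field_simp
    have e2 := dens_identity (x := x) h1 rfl rfl h2
    have e3 : Real.exp (-L n) = (n : ℝ)⁻¹ := by
      rw [Real.exp_neg, hLdef, Real.exp_log h4]
    have e4 : g n = (n : ℝ)⁻¹ * (e * ((1 + u n)⁻¹ * Real.exp (-(c n ^ 2 / (4 * L n))))) := by
      rw [← e3]; exact e2
    rw [e1, e4, hWdef]
    field_simp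
  have hp0 : Tendsto p atTop (𝓝 0) := by
    have := (hW1.const_mul e).mul (tendsto_inv_atTop_zero.comp hNat)
    rw [mul_zero] at this
    refine this.congr' ?_
    filter_upwards [hp, hn0] with n h1 h2
    rw [← h1]; simp only [Function.comp]; field_simp
  have hq : Tendsto (fun n : ℕ => (n * Real.log (1 - p n) + n * p n) / r n) atTop (𝓝 0) := by
    have hq1 : Tendsto (fun n => 1 - p n) atTop (𝓝 1) := by simpa using hp0.const_sub 1
    have hb := ((((hW1.const_mul e).pow 2).mul (hq1.inv₀ one_ne_zero)).mul
      (hLn.mul (hyi.pow 2))).const_mul 16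
    rw [zero_mul, mul_zero, mul_zero] at hb
    refine squeeze_zero_norm' ?_ hb
    filter_upwards [hp, hn0, hr0, hL0, hy0, hq1.eventually_const_lt one_pos]
      with n h1 h2 h3 h4 h5 h6
    have b1 := Real.log_le_sub_one_of_pos h6
    have b2 := Real.one_sub_inv_le_log_of_pos h6
    have b3 : |(n : ℝ) * Real.log (1 - p n) + n * p n| ≤ n * (p n ^ 2 * (1 - p n)⁻¹) := by
      rw [← mul_add, abs_mul, abs_of_pos h2]
      gcongr
      rw [abs_of_nonpos (by linarith)]
      have : p n ^ 2 * (1 - p n)⁻¹ = (1 - p n)⁻¹ - 1 - p n := by field_simp; ring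
      rw [this]; linarith
    rw [Real.norm_eq_abs, abs_div, abs_of_pos h3, ← h1]
    calc _ ≤ n * (p n ^ 2 * (1 - p n)⁻¹) / r n := by gcongr
      _ = _ := by
        generalize (1 - p n)⁻¹ = q
        simp only [hrdef]
        field_simp
  have hD : Tendsto (fun n : ℕ => (n * Real.log (1 - p n) + e) / r n) atTop (𝓝 e) := by
    have := (hW.const_mul e).add hq
    rw [mul_one, add_zero] at this
    refine this.congr' ?_
    filter_upwards [hp] with n h1
    rw [h1, hWdef]; ring
  have hE := (exp_rate hr hr0 hD).const_mul (gumbel x)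
  refine hE.congr' ?_
  filter_upwards [hL0, hy0, hp0.eventually_lt_const one_pos] with n h1 h2 h3
  have ha0 : 0 < a n := by simp only [hadef]; positivity
  have ha2 : a n ^ 2 = 2 * L n := Real.sq_sqrt (by positivity)
  have ez : (a n)⁻¹ * x + (a n - (y n + Real.log Real.pi) / (2 * a n)) = z n := by
    simp only [hzdef, hudef, hcdef]
    rw [← ha2]
    field_simp
    try ring
  have ef : snCdf l (z n) ^ n = gumbel x * Real.exp (n * Real.log (1 - p n) + e) := by
    have : snCdf l (z n) = 1 - p n := by simp only [hpdef]; ring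
    rw [this, gumbel, ← Real.exp_add]
    have e5 : -Real.exp (-x) + (n * Real.log (1 - p n) + e) = n * Real.log (1 - p n) := by
      rw [hedef]; ring
    rw [e5, Real.exp_nat_mul, Real.exp_log (by linarith)]
  change _ = (snCdf l ((a n)⁻¹ * x + (a n - (y n + Real.log Real.pi) / (2 * a n))) ^ n
    - gumbel x) * (16 * L n) / (y n) ^ 2
  rw [ez, ef]
  generalize Real.exp (n * Real.log (1 - p n) + e) = Q
  simp only [hrdef]
  field_simp
end

section
/- Let λ < 0, and for n ≥ 2 let b_n be the unique real number with F_λ(b_n) = 1 - 1/n, and set a_n = 1/((1+λ²) b_n). Define κ(x) = 2^{-1}(1+λ²)^{-1}(x² + 4x) e^{-x} and ω(x) = -8^{-1} λ^{-2} (1+λ²)^{-2} (λ² x⁴ + 8λ² x³ + 24λ² x² + 16(1+3λ²) x) e^{-x}. Then for every real x, b_n² · ( b_n² · ((F_λ(a_n x + b_n))^n - Λ(x)) - κ(x) Λ(x) ) → (ω(x) + κ(x)²/2) Λ(x) as n → ∞. -/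
open Real MeasureTheory Filter Topology

/-- $\kappa(x)$ for $\lambda<0$. -/
noncomputable def kappaNeg (l x : ℝ) : ℝ :=
  2⁻¹ * (1 + l ^ 2)⁻¹ * (x ^ 2 + 4 * x) * Real.exp (-x)

/-- $\omega(x)$ for $\lambda<0$. -/
noncomputable def omegaNeg (l x : ℝ) : ℝ :=
  -(8⁻¹ * (l ^ 2)⁻¹ * ((1 + l ^ 2) ^ 2)⁻¹ *
    (l ^ 2 * x ^ 4 + 8 * l ^ 2 * x ^ 3 + 24 * l ^ 2 * x ^ 2 +
      16 * (1 + 3 * l ^ 2) * x) * Real.exp (-x))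


namespace SkewAux

lemma hasDerivAt_Iic {f : ℝ → ℝ} (hf : Continuous f) (hi : Integrable f) (x : ℝ) :
    HasDerivAt (fun y => ∫ t in Set.Iic y, f t) (f x) x := by
  have h1 : HasDerivAt (fun y => ∫ t in (0:ℝ)..y, f t) (f x) x :=
    intervalIntegral.integral_hasDerivAt_right (hf.intervalIntegrable _ _)
      hf.stronglyMeasurable.stronglyMeasurableAtFilter hf.continuousAt
  have h2 := h1.add_const (∫ t in Set.Iic (0:ℝ), f t)
  refine h2.congr_of_eventuallyEq (Eventually.of_forall fun y => ?_)
  have := intervalIntegral.integral_Iic_sub_Iic (a := 0) (b := y) (μ := volume) (f := f)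
    hi.integrableOn hi.integrableOn
  simp only
  linarith

lemma tendsto_Iic_top {f : ℝ → ℝ} (hi : Integrable f) :
    Tendsto (fun y => ∫ t in Set.Iic y, f t) atTop (𝓝 (∫ t, f t)) :=
  (aecover_Iic tendsto_id).integral_tendsto_of_countably_generated hi

lemma split_Iic {f : ℝ → ℝ} (hi : Integrable f) (x : ℝ) :
    (∫ t in Set.Iic x, f t) + ∫ t in Set.Ioi x, f t = ∫ t, f t :=
  intervalIntegral.integral_Iic_add_Ioi hi.integrableOn hi.integrableOn

lemma stdPhi_eq : stdPhi = ProbabilityTheory.gaussianPDFReal 0 1 := by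
  ext x
  simp [stdPhi, ProbabilityTheory.gaussianPDFReal]

lemma stdPhi_cont : Continuous stdPhi := by
  unfold stdPhi; fun_prop

lemma stdPhi_pos (x : ℝ) : 0 < stdPhi x := by
  unfold stdPhi; positivity

lemma stdPhi_int : Integrable stdPhi := by
  rw [stdPhi_eq]; exact ProbabilityTheory.integrable_gaussianPDFReal 0 1

lemma stdPhi_total : ∫ t, stdPhi t = 1 := by
  rw [stdPhi_eq]; exact ProbabilityTheory.integral_gaussianPDFReal_eq_one 0 one_ne_zero

lemma stdPhi_neg (x : ℝ) : stdPhi (-x) = stdPhi x := by simp [stdPhi]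

lemma stdCdf_deriv (x : ℝ) : HasDerivAt stdCdf (stdPhi x) x :=
  hasDerivAt_Iic stdPhi_cont stdPhi_int x

lemma stdCdf_cont : Continuous stdCdf :=
  continuous_iff_continuousAt.2 fun x => (stdCdf_deriv x).continuousAt

lemma stdCdf_neg (x : ℝ) : stdCdf (-x) = 1 - stdCdf x := by
  have h1 := split_Iic stdPhi_int x
  rw [stdPhi_total] at h1
  have h2 := integral_comp_neg_Iic (-x) stdPhi
  simp only [stdPhi_neg, neg_neg] at h2
  unfold stdCdf
  rw [h2]; linarith

lemma stdCdf_top : Tendsto stdCdf atTop (𝓝 1) := by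
  have := tendsto_Iic_top stdPhi_int
  rwa [stdPhi_total] at this

lemma stdCdf_tail : Tendsto (fun s => stdCdf (-s)) atTop (𝓝 0) := by
  simp only [stdCdf_neg]
  simpa using stdCdf_top.const_sub 1

lemma stdCdf_strictMono : StrictMono stdCdf :=
  strictMono_of_deriv_pos fun x => by rw [(stdCdf_deriv x).deriv]; exact stdPhi_pos x

lemma stdCdf_nonneg (x : ℝ) : 0 ≤ stdCdf x :=
  integral_nonneg fun t => (stdPhi_pos t).le

lemma stdCdf_pos (x : ℝ) : 0 < stdCdf x :=
  (stdCdf_nonneg (x - 1)).trans_lt (stdCdf_strictMono (by linarith))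

lemma stdCdf_le (x : ℝ) : stdCdf x ≤ 1 := by
  have := stdCdf_nonneg (-x); rw [stdCdf_neg] at this; linarith

lemma snPdf_cont (l : ℝ) : Continuous (snPdf l) := by
  unfold snPdf
  exact (continuous_const.mul stdPhi_cont).mul (stdCdf_cont.comp (continuous_const.mul continuous_id))

lemma snPdf_pos (l x : ℝ) : 0 < snPdf l x :=
  mul_pos (mul_pos two_pos (stdPhi_pos x)) (stdCdf_pos _)

lemma snPdf_int (l : ℝ) : Integrable (snPdf l) := by
  have h : Integrable (fun x => 2 * stdPhi x) := stdPhi_int.const_mul 2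
  refine h.mono' (snPdf_cont l).aestronglyMeasurable (Eventually.of_forall fun x => ?_)
  rw [Real.norm_of_nonneg (snPdf_pos l x).le]
  unfold snPdf
  have := stdPhi_pos x
  nlinarith [stdCdf_le (l * x)]

lemma snPdf_total (l : ℝ) : ∫ t, snPdf l t = 1 := by
  have h1 : ∫ t, snPdf l (-t) = ∫ t, snPdf l t := integral_neg_eq_self (snPdf l) volume
  have h2 : ∀ t, snPdf l (-t) = 2 * stdPhi t - snPdf l t := by
    intro t
    unfold snPdf
    rw [stdPhi_neg, mul_neg, stdCdf_neg]; ring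
  simp only [h2] at h1
  rw [integral_sub (stdPhi_int.const_mul 2) (snPdf_int l), integral_const_mul, stdPhi_total] at h1
  linarith

lemma snCdf_deriv (l x : ℝ) : HasDerivAt (snCdf l) (snPdf l x) x :=
  hasDerivAt_Iic (snPdf_cont l) (snPdf_int l) x

lemma snCdf_strictMono (l : ℝ) : StrictMono (snCdf l) :=
  strictMono_of_deriv_pos fun x => by rw [(snCdf_deriv l x).deriv]; exact snPdf_pos l x

lemma snCdf_top (l : ℝ) : Tendsto (snCdf l) atTop (𝓝 1) := by
  have := tendsto_Iic_top (snPdf_int l)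
  rwa [snPdf_total] at this

lemma snCdf_le (l x : ℝ) : snCdf l x ≤ 1 :=
  (snCdf_strictMono l).monotone.ge_of_tendsto (snCdf_top l) x

lemma snCdf_lt (l x : ℝ) : snCdf l x < 1 :=
  (snCdf_strictMono l (by linarith : x < x + 1)).trans_le (snCdf_le l _)

lemma b_top (l : ℝ) (b : ℕ → ℝ) (hb : ∀ n : ℕ, 2 ≤ n → snCdf l (b n) = 1 - 1 / n) :
    Tendsto b atTop atTop := by
  rw [tendsto_atTop]
  intro M
  have h1 : Tendsto (fun n : ℕ => 1 - 1 / (n:ℝ)) atTop (𝓝 1) := by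
    simpa using (tendsto_one_div_atTop_nhds_zero_nat (𝕜 := ℝ)).const_sub 1
  filter_upwards [h1.eventually_const_lt (snCdf_lt l M), eventually_ge_atTop 2] with n hn h2
  rw [← hb n h2] at hn
  exact ((snCdf_strictMono l).lt_iff_lt.1 hn).le

/-! ### Gaussian-type asymptotics -/

noncomputable def gE (c t : ℝ) : ℝ := Real.exp (-(c * t ^ 2) / 2)

lemma gE_pos (c t : ℝ) : 0 < gE c t := Real.exp_pos _

lemma gE_deriv (c t : ℝ) : HasDerivAt (gE c) (gE c t * (-(c * t))) t := by
  unfold gE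
  have h : HasDerivAt (fun t : ℝ => -(c * t ^ 2) / 2) (-(c * t)) t := by
    have := (((hasDerivAt_pow 2 t).const_mul c).neg).div_const 2
    exact this.congr_deriv (by push_cast; ring)
  exact h.exp

lemma gE_pow_deriv (c t : ℝ) (ht : t ≠ 0) (m : ℕ) :
    HasDerivAt (fun t => gE c t * t⁻¹ ^ (m + 1))
      (gE c t * (-c * t⁻¹ ^ m - (m + 1) * t⁻¹ ^ (m + 2))) t := by
  have h := (gE_deriv c t).mul ((hasDerivAt_inv ht).pow (m + 1))
  refine h.congr_deriv ?_
  have e : t * t⁻¹ = 1 := mul_inv_cancel₀ ht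
  simp only [Nat.add_sub_cancel, Pi.pow_apply, inv_pow]
  rw [← inv_pow, ← inv_pow, ← inv_pow, ← inv_pow, pow_succ t⁻¹ m, pow_add t⁻¹ m 2]
  push_cast
  linear_combination (-(c * gE c t * t⁻¹ ^ m)) * e

lemma inv_pow_tendsto (m : ℕ) : Tendsto (fun t : ℝ => t⁻¹ ^ (m + 1)) atTop (𝓝 0) := by
  have := (tendsto_inv_atTop_zero (𝕜 := ℝ)).pow (m + 1)
  simpa using this

lemma gE_pow_tendsto (c : ℝ) (hc : 0 < c) (m : ℕ) :
    Tendsto (fun t => gE c t * t⁻¹ ^ (m + 1)) atTop (𝓝 0) := by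
  refine squeeze_zero' ?_ ?_ (inv_pow_tendsto m)
  · filter_upwards [eventually_gt_atTop 0] with t ht
    have := gE_pos c t; positivity
  · filter_upwards [eventually_gt_atTop 0] with t ht
    have h : gE c t ≤ 1 := by
      unfold gE; rw [Real.exp_le_one_iff]
      have := mul_pos hc (pow_pos ht 2); linarith
    have : 0 ≤ t⁻¹ ^ (m + 1) := by positivity
    nlinarith

/-- Mills ratio for the standard normal. -/
lemma mills : Tendsto (fun s => (stdCdf (-s) - (stdPhi s * s⁻¹ - stdPhi s * s⁻¹ ^ 3)) /
    (stdPhi s * s⁻¹ ^ 5)) atTop (𝓝 3) := by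
  have hφ : ∀ s, stdPhi s = (Real.sqrt (2 * Real.pi))⁻¹ * gE 1 s := by
    intro s; simp [stdPhi, gE]
  set K := (Real.sqrt (2 * Real.pi))⁻¹ with hK
  have hKpos : 0 < K := by positivity
  have hlim : ∀ m, Tendsto (fun s => stdPhi s * s⁻¹ ^ (m + 1)) atTop (𝓝 0) := by
    intro m
    have := (gE_pow_tendsto 1 one_pos m).const_mul K
    simp only [mul_zero] at this
    refine this.congr fun s => ?_
    rw [hφ]; ring
  have hder : ∀ m : ℕ, ∀ s : ℝ, s ≠ 0 → HasDerivAt (fun s => stdPhi s * s⁻¹ ^ (m + 1))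
      (stdPhi s * (-s⁻¹ ^ m - (m + 1) * s⁻¹ ^ (m + 2))) s := by
    intro m s hs
    have := (gE_pow_deriv 1 s hs m).const_mul K
    refine (this.congr_deriv (by rw [hφ]; ring)).congr_of_eventuallyEq
      (Eventually.of_forall fun s => ?_)
    simp only [hφ]; ring
  refine HasDerivAt.lhopital_zero_atTop
    (f' := fun s => -stdPhi s - (stdPhi s * (-s⁻¹ ^ 0 - ((0:ℕ) + 1) * s⁻¹ ^ 2) -
      stdPhi s * (-s⁻¹ ^ 2 - ((2:ℕ) + 1) * s⁻¹ ^ 4)))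
    (g' := fun s => stdPhi s * (-s⁻¹ ^ 4 - ((4:ℕ) + 1) * s⁻¹ ^ 6)) ?_ ?_ ?_ ?_ ?_ ?_
  · filter_upwards [eventually_gt_atTop 0] with s hs
    have h1 : HasDerivAt (fun s => stdCdf (-s)) (-stdPhi s) s := by
      have := (stdCdf_deriv (-s)).comp s (hasDerivAt_neg s)
      rw [stdPhi_neg] at this
      refine this.congr_deriv (by ring)
    have h0 := hder 0 s hs.ne'
    simp only [zero_add, pow_one] at h0
    have h := h1.sub (h0.sub (hder 2 s hs.ne'))
    refine h.congr_deriv (by simp)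
  · filter_upwards [eventually_gt_atTop 0] with s hs
    exact hder 4 s hs.ne'
  · filter_upwards [eventually_gt_atTop 0] with s hs
    have := stdPhi_pos s
    have : 0 < s⁻¹ ^ 4 + ((4:ℕ) + 1) * s⁻¹ ^ 6 := by positivity
    refine mul_ne_zero (stdPhi_pos s).ne' (by linarith)
  · have h0 := hlim 0
    simp only [zero_add, pow_one] at h0
    simpa using stdCdf_tail.sub (h0.sub (hlim 2))
  · exact hlim 4
  · have h : Tendsto (fun s : ℝ => 3 / (1 + 5 * s⁻¹ ^ 2)) atTop (𝓝 3) := by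
      have := ((inv_pow_tendsto 1).const_mul 5).const_add 1
      have := (tendsto_const_nhds (x := (3:ℝ))).div this (by norm_num)
      rw [show (3:ℝ) / (1 + 5 * 0) = 3 by norm_num] at this
      exact this
    refine h.congr' ?_
    filter_upwards [eventually_gt_atTop 0] with s hs
    have := stdPhi_pos s
    have h2 : -s⁻¹ ^ 4 - ((4:ℕ) + 1) * s⁻¹ ^ 6 ≠ 0 := by
      have : 0 < s⁻¹ ^ 4 + ((4:ℕ) + 1) * s⁻¹ ^ 6 := by positivity
      linarith
    rw [div_eq_div_iff (by positivity) (mul_ne_zero (stdPhi_pos s).ne' h2)]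
    push_cast
    ring

lemma phi_mul (k t : ℝ) :
    2 * stdPhi t * stdPhi (k * t) = Real.pi⁻¹ * gE (1 + k ^ 2) t := by
  have h : (Real.sqrt (2 * Real.pi))⁻¹ * (Real.sqrt (2 * Real.pi))⁻¹ = (2 * Real.pi)⁻¹ := by
    rw [← mul_inv, Real.mul_self_sqrt (by positivity)]
  have h2 : Real.exp (-(t ^ 2) / 2) * Real.exp (-((k * t) ^ 2) / 2) = gE (1 + k ^ 2) t := by
    unfold gE; rw [← Real.exp_add]; congr 1; ring
  unfold stdPhi
  calc _ = 2 * ((Real.sqrt (2 * Real.pi))⁻¹ * (Real.sqrt (2 * Real.pi))⁻¹) *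
      (Real.exp (-(t ^ 2) / 2) * Real.exp (-((k * t) ^ 2) / 2)) := by ring
    _ = _ := by rw [h, h2, mul_inv]; ring

/-- Expansion of the skew normal tail. -/
lemma tail_lim (l : ℝ) (hl : l < 0) (c k β : ℝ) (hc : c = 1 + l ^ 2) (hk : k = -l)
    (hβ : β = 2 / c + 1 / k ^ 2) :
    Tendsto (fun t => (Real.pi * k * c * (1 - snCdf l t) - (gE c t * t⁻¹ ^ 2 - β * (gE c t * t⁻¹ ^ 4))) /
      (gE c t * t⁻¹ ^ 6)) atTop (𝓝 (3 / k ^ 4 + 4 * β / c)) := by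
  have hkpos : 0 < k := by linarith
  have hcpos : 0 < c := by rw [hc]; positivity
  have hpi := Real.pi_pos
  have hck : c = 1 + k ^ 2 := by rw [hc, hk]; ring
  -- remainder in Mills
  obtain ⟨r, hr, hrt⟩ : ∃ r : ℝ → ℝ, Tendsto r atTop (𝓝 3) ∧ ∀ t, 0 < t →
      Real.pi * k * snPdf l t = gE c t * (t⁻¹ - k⁻¹ ^ 2 * t⁻¹ ^ 3 + r t * k⁻¹ ^ 4 * t⁻¹ ^ 5) := by
    refine ⟨_, mills.comp (tendsto_id.const_mul_atTop hkpos), fun t ht => ?_⟩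
    have hpos : 0 < stdPhi (k * t) * (k * t)⁻¹ ^ 5 := by
      have := stdPhi_pos (k * t); positivity
    simp only [Function.comp, id]
    set q := (stdCdf (-(k * t)) - (stdPhi (k * t) * (k * t)⁻¹ - stdPhi (k * t) * (k * t)⁻¹ ^ 3)) /
      (stdPhi (k * t) * (k * t)⁻¹ ^ 5) with hq
    have h1 : q * (stdPhi (k * t) * (k * t)⁻¹ ^ 5) =
      (stdCdf (-(k * t)) - (stdPhi (k * t) * (k * t)⁻¹ - stdPhi (k * t) * (k * t)⁻¹ ^ 3)) :=
      div_mul_cancel₀ _ hpos.ne'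
    have h2 := phi_mul k t
    rw [← hck] at h2
    have h3 : gE c t = Real.pi * (2 * stdPhi t * stdPhi (k * t)) := by
      rw [h2]; field_simp
    have h4 : l * t = -(k * t) := by rw [hk]; ring
    unfold snPdf
    rw [h3, h4]
    have h5 : stdCdf (-(k * t)) = q * (stdPhi (k * t) * (k * t)⁻¹ ^ 5) +
      (stdPhi (k * t) * (k * t)⁻¹ - stdPhi (k * t) * (k * t)⁻¹ ^ 3) := by linarith
    rw [h5, mul_inv]
    have e : k * k⁻¹ = 1 := mul_inv_cancel₀ hkpos.ne'
    clear_value q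
    generalize stdPhi t = A
    generalize stdPhi (k * t) = B
    field_simp
    ring
  refine HasDerivAt.lhopital_zero_atTop
    (f' := fun t => Real.pi * k * c * (-snPdf l t) -
      (gE c t * (-c * t⁻¹ ^ 1 - ((1:ℕ) + 1) * t⁻¹ ^ 3) -
      β * (gE c t * (-c * t⁻¹ ^ 3 - ((3:ℕ) + 1) * t⁻¹ ^ 5))))
    (g' := fun t => gE c t * (-c * t⁻¹ ^ 5 - ((5:ℕ) + 1) * t⁻¹ ^ 7)) ?_ ?_ ?_ ?_ ?_ ?_
  · filter_upwards [eventually_gt_atTop 0] with t ht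
    exact (((snCdf_deriv l t).const_sub 1).const_mul _).sub
      ((gE_pow_deriv c t ht.ne' 1).sub ((gE_pow_deriv c t ht.ne' 3).const_mul β))
  · filter_upwards [eventually_gt_atTop 0] with t ht
    exact gE_pow_deriv c t ht.ne' 5
  · filter_upwards [eventually_gt_atTop 0] with t ht
    have : 0 < c * t⁻¹ ^ 5 + ((5:ℕ) + 1) * t⁻¹ ^ 7 := by positivity
    refine mul_ne_zero (gE_pos c t).ne' (by linarith)
  · have h1 := ((snCdf_top l).const_sub 1).const_mul (Real.pi * k * c)
    have := h1.sub ((gE_pow_tendsto c hcpos 1).sub ((gE_pow_tendsto c hcpos 3).const_mul β))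
    simpa using this
  · exact gE_pow_tendsto c hcpos 5
  · have h : Tendsto (fun t : ℝ => (c * k⁻¹ ^ 4 * r t + 4 * β) / (c + 6 * t⁻¹ ^ 2)) atTop
        (𝓝 (3 / k ^ 4 + 4 * β / c)) := by
      have h1 := ((inv_pow_tendsto 1).const_mul 6).const_add c
      have h2 := (hr.const_mul (c * k⁻¹ ^ 4)).add_const (4 * β)
      have h3 := h2.div h1 (by simpa using hcpos.ne')
      have e : (c * k⁻¹ ^ 4 * 3 + 4 * β) / (c + 6 * 0) = 3 / k ^ 4 + 4 * β / c := by
        rw [mul_zero, add_zero]; field_simp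
      rw [e] at h3
      exact h3
    refine h.congr' ?_
    filter_upwards [eventually_gt_atTop 0] with t ht
    have h2 : -c * t⁻¹ ^ 5 - ((5:ℕ) + 1) * t⁻¹ ^ 7 ≠ 0 := by
      have : 0 < c * t⁻¹ ^ 5 + ((5:ℕ) + 1) * t⁻¹ ^ 7 := by positivity
      linarith
    rw [div_eq_div_iff (by positivity) (mul_ne_zero (gE_pos c t).ne' h2)]
    have h3 := hrt t ht
    have h4 : Real.pi * k * c * (-snPdf l t) =
      -c * (gE c t * (t⁻¹ - k⁻¹ ^ 2 * t⁻¹ ^ 3 + r t * k⁻¹ ^ 4 * t⁻¹ ^ 5)) := by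
      rw [← h3]; ring
    rw [h4]
    have h5 : c * β = 2 + c * k⁻¹ ^ 2 := by rw [hβ]; field_simp
    push_cast
    linear_combination (gE c t * t⁻¹ ^ 3 * (c + 6 * t⁻¹ ^ 2)) * h5

/-- Expansion of the skew normal tail. -/
lemma tail_exp (l : ℝ) (hl : l < 0) (c k β : ℝ) (hc : c = 1 + l ^ 2) (hk : k = -l)
    (hβ : β = 2 / c + 1 / k ^ 2) :
    ∃ (ρ : ℝ → ℝ) (γ : ℝ), Tendsto ρ atTop (𝓝 γ) ∧ ∀ t, 0 < t →
      Real.pi * k * c * (1 - snCdf l t) =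
        gE c t * t⁻¹ ^ 2 * (1 - β * t⁻¹ ^ 2 + ρ t * t⁻¹ ^ 4) := by
  refine ⟨_, _, tail_lim l hl c k β hc hk hβ, fun t ht => ?_⟩
  have := gE_pos c t
  have h : gE c t * t⁻¹ ^ 6 ≠ 0 := by positivity
  have h2 := div_mul_cancel₀ (Real.pi * k * c * (1 - snCdf l t) - (gE c t * t⁻¹ ^ 2 - β * (gE c t * t⁻¹ ^ 4))) h
  linear_combination -h2

/-! ### Second-order expansions along a sequence -/

def X2 (h F : ℕ → ℝ) (a0 a1 a2 : ℝ) : Prop :=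
  ∃ p : ℕ → ℝ, Tendsto p atTop (𝓝 a2) ∧ ∀ᶠ n in atTop, F n = a0 + a1 * h n + h n ^ 2 * p n

lemma X2.mul {h F G : ℕ → ℝ} {a0 a1 a2 b0 b1 b2 : ℝ} (hh : Tendsto h atTop (𝓝 0))
    (hF : X2 h F a0 a1 a2) (hG : X2 h G b0 b1 b2) :
    X2 h (fun n => F n * G n) (a0 * b0) (a0 * b1 + a1 * b0) (a0 * b2 + a1 * b1 + a2 * b0) := by
  obtain ⟨p, hp, hFp⟩ := hF
  obtain ⟨q, hq, hGq⟩ := hG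
  refine ⟨fun n => a0 * q n + a1 * b1 + p n * b0 + h n * (a1 * q n + b1 * p n) +
    h n ^ 2 * (p n * q n), ?_, ?_⟩
  · have := ((((hq.const_mul a0).add_const (a1 * b1)).add (hp.mul_const b0)).add
      (hh.mul ((hq.const_mul a1).add (hp.const_mul b1)))).add ((hh.pow 2).mul (hp.mul hq))
    simpa using this
  · filter_upwards [hFp, hGq] with n h1 h2
    rw [h1, h2]; ring

lemma exp_quad : ∃ q : ℝ → ℝ, Tendsto q (𝓝 0) (𝓝 (1 / 2)) ∧
    ∀ u, Real.exp u = 1 + u + u ^ 2 * q u := by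
  refine ⟨fun u => if u = 0 then 1 / 2 else (Real.exp u - 1 - u) / u ^ 2, ?_, ?_⟩
  · rw [tendsto_iff_norm_sub_tendsto_zero]
    have h0 : Tendsto (fun u : ℝ => |u|) (𝓝 0) (𝓝 0) := by
      simpa using (continuous_abs.tendsto (0:ℝ))
    refine squeeze_zero' (Eventually.of_forall fun _ => norm_nonneg _) ?_ h0
    have : ∀ᶠ u : ℝ in 𝓝 0, |u| < 1 := h0.eventually_lt_const (by norm_num)
    filter_upwards [this] with u hu
    by_cases h : u = 0
    · simp [h]
    · simp only [h, if_false]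
      have h3 := Real.exp_bound hu.le (n := 3) (by norm_num)
      simp only [Finset.sum_range_succ, Finset.sum_range_zero, Nat.factorial] at h3
      norm_num at h3
      have hu2 : 0 < u ^ 2 := by positivity
      have e : (Real.exp u - 1 - u) / u ^ 2 - 1 / 2 = (Real.exp u - (1 + u + u ^ 2 / 2)) / u ^ 2 := by
        field_simp; ring
      rw [e, Real.norm_eq_abs, abs_div, abs_of_pos hu2, div_le_iff₀ hu2]
      refine h3.trans ?_
      have : |u| ^ 3 = |u| * u ^ 2 := by rw [pow_succ, sq_abs]; ring
      rw [this]
      have : 0 ≤ |u| * u ^ 2 := by positivity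
      linarith
  · intro u
    by_cases h : u = 0
    · simp [h]
    · simp only [h, if_false]; field_simp; ring

lemma X2.exp {h F : ℕ → ℝ} {a0 a1 a2 : ℝ} (hh : Tendsto h atTop (𝓝 0))
    (hF : X2 h F a0 a1 a2) :
    X2 h (fun n => Real.exp (F n)) (Real.exp a0) (Real.exp a0 * a1)
      (Real.exp a0 * (a2 + a1 ^ 2 / 2)) := by
  obtain ⟨p, hp, hFp⟩ := hF
  obtain ⟨q, hq, hqe⟩ := exp_quad
  have hv : Tendsto (fun n => a1 + h n * p n) atTop (𝓝 a1) := by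
    simpa using (hh.mul hp).const_add a1
  have hu : Tendsto (fun n => h n * (a1 + h n * p n)) atTop (𝓝 0) := by
    simpa using hh.mul hv
  refine ⟨fun n => Real.exp a0 * (p n + (a1 + h n * p n) ^ 2 * q (h n * (a1 + h n * p n))), ?_, ?_⟩
  · have := (hp.add ((hv.pow 2).mul (hq.comp hu))).const_mul (Real.exp a0)
    rw [mul_one_div] at this
    exact this
  · filter_upwards [hFp] with n h1
    rw [h1, show a0 + a1 * h n + h n ^ 2 * p n = a0 + h n * (a1 + h n * p n) by ring, Real.exp_add,
      hqe (h n * (a1 + h n * p n))]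
    ring

lemma log_bound {y : ℝ} (hy : y < 1) : |Real.log (1 - y) + y| ≤ y ^ 2 / (1 - y) := by
  have h1 : 0 < 1 - y := by linarith
  have h2 := Real.log_le_sub_one_of_pos h1
  have h3 := Real.one_sub_inv_le_log_of_pos h1
  have e : y ^ 2 / (1 - y) = (1 - y)⁻¹ - 1 - y := by field_simp; ring
  rw [e, abs_le]
  constructor <;> linarith [abs_nonneg y, (by rw [← e]; positivity : 0 ≤ (1 - y)⁻¹ - 1 - y)]

lemma gE_sq_tendsto (c : ℝ) (hc : 0 < c) : Tendsto (fun t => gE c t * t ^ 2) atTop (𝓝 0) := by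
  have h1 : Tendsto (fun t : ℝ => c / 2 * t ^ 2) atTop atTop :=
    (tendsto_pow_atTop two_ne_zero).const_mul_atTop (by positivity)
  have h2 := ((Real.tendsto_pow_mul_exp_neg_atTop_nhds_zero 1).comp h1).const_mul (2 / c)
  rw [mul_zero] at h2
  refine h2.congr fun t => ?_
  simp only [Function.comp, gE, pow_one]
  rw [show -(c / 2 * t ^ 2) = -(c * t ^ 2) / 2 by ring]
  field_simp

end SkewAux

open SkewAux

theorem skew_normal_expansion_neg (l : ℝ) (hl : l < 0) (b : ℕ → ℝ)
    (hb : ∀ n : ℕ, 2 ≤ n → snCdf l (b n) = 1 - 1 / n) (x : ℝ) :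
    Tendsto (fun n : ℕ =>
      (b n) ^ 2 * ((b n) ^ 2 *
        ((snCdf l (((1 + l ^ 2) * b n)⁻¹ * x + b n)) ^ n - gumbel x) -
        kappaNeg l x * gumbel x)) atTop
      (𝓝 ((omegaNeg l x + (kappaNeg l x) ^ 2 / 2) * gumbel x)) := by
  obtain ⟨c, hc⟩ : ∃ c, c = 1 + l ^ 2 := ⟨_, rfl⟩
  obtain ⟨k, hk⟩ : ∃ k, k = -l := ⟨_, rfl⟩
  obtain ⟨β, hβ⟩ : ∃ β, β = 2 / c + 1 / k ^ 2 := ⟨_, rfl⟩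
  have hkpos : 0 < k := by linarith
  have hcpos : 0 < c := by rw [hc]; positivity
  have hpi := Real.pi_pos
  obtain ⟨ρ, γ, hρ, hT⟩ := tail_exp l hl c k β hc hk hβ
  have hbt := b_top l b hb
  obtain ⟨d, hd⟩ : ∃ d, d = x / c := ⟨_, rfl⟩
  set h : ℕ → ℝ := fun n => (b n)⁻¹ ^ 2 with hhdef
  have hh : Tendsto h atTop (𝓝 0) := (inv_pow_tendsto 1).comp hbt
  set w : ℕ → ℝ := fun n => (1 + d * h n)⁻¹ with hwdef
  have h1d : Tendsto (fun n => 1 + d * h n) atTop (𝓝 1) := by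
    simpa using (hh.const_mul d).const_add 1
  have hw : Tendsto w atTop (𝓝 1) := by
    simpa using h1d.inv₀ one_ne_zero
  set t : ℕ → ℝ := fun n => ((1 + l ^ 2) * b n)⁻¹ * x + b n with htdef
  have hbpos : ∀ᶠ n in atTop, 0 < b n := hbt.eventually_gt_atTop 0
  have h1dpos : ∀ᶠ n in atTop, 0 < 1 + d * h n := h1d.eventually_const_lt one_pos
  have htt : Tendsto t atTop atTop := by
    have h1 : Tendsto (fun n => ((1 + l ^ 2) * b n)⁻¹ * x) atTop (𝓝 0) := by
      rw [← hc]
      simpa using (tendsto_inv_atTop_zero.comp (hbt.const_mul_atTop hcpos)).mul_const x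
    exact h1.add_atTop hbt
  have htpos : ∀ᶠ n in atTop, 0 < t n := htt.eventually_gt_atTop 0
  have htb : ∀ᶠ n in atTop, t n = b n * (1 + d * h n) := by
    filter_upwards [hbpos] with n hn
    simp only [htdef, hhdef, hd, ← hc]
    field_simp
    ring
  have hwt : ∀ᶠ n in atTop, (t n)⁻¹ = (b n)⁻¹ * w n := by
    filter_upwards [htb] with n hn
    rw [hn, mul_inv]
  set J : ℝ → ℝ := fun t => 1 - β * t⁻¹ ^ 2 + ρ t * t⁻¹ ^ 4 with hJdef
  have hJ : Tendsto J atTop (𝓝 1) := by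
    have := (((inv_pow_tendsto 1).const_mul β).const_sub 1).add (hρ.mul (inv_pow_tendsto 3))
    simpa [hJdef] using this
  have hJb := hJ.comp hbt
  have hJbpos : ∀ᶠ n in atTop, 0 < J (b n) := hJb.eventually_const_lt one_pos
  -- the ratio
  set R : ℕ → ℝ := fun n => n * (1 - snCdf l (t n)) with hRdef
  have hnT : ∀ᶠ n : ℕ in atTop, (n : ℝ) * (1 - snCdf l (b n)) = 1 := by
    filter_upwards [eventually_ge_atTop 2] with n hn
    have : (n:ℝ) ≠ 0 := by positivity
    rw [hb n hn]; field_simp; ring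
  have hR : ∀ᶠ n in atTop, R n =
      Real.exp (-x + -(x ^ 2 / (2 * c)) * h n) * (w n * w n) * (J (t n) / J (b n)) := by
    filter_upwards [hbpos, htpos, htb, hwt, hJbpos, hnT] with n h1 h2 h3 h4 h5 h6
    have e1 := hT (t n) h2
    have e2 := hT (b n) h1
    have e3 : gE c (t n) = gE c (b n) * Real.exp (-x + -(x ^ 2 / (2 * c)) * h n) := by
      unfold gE
      rw [← Real.exp_add, h3]
      congr 1
      simp only [hhdef, hd]
      field_simp
      ring
    change _ = gE c (t n) * (t n)⁻¹ ^ 2 * J (t n) at e1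
    change _ = gE c (b n) * (b n)⁻¹ ^ 2 * J (b n) at e2
    have hg := gE_pos c (b n)
    have hD : 0 < gE c (b n) * (b n)⁻¹ ^ 2 * J (b n) := by positivity
    have e4 : R n * (gE c (b n) * (b n)⁻¹ ^ 2 * J (b n)) = gE c (t n) * (t n)⁻¹ ^ 2 * J (t n) := by
      rw [← e1, ← e2]
      simp only [hRdef]
      linear_combination (π * k * c * (1 - snCdf l (t n))) * h6
    refine mul_right_cancel₀ hD.ne' ?_
    rw [e4, e3, h4]
    have : J (t n) / J (b n) * J (b n) = J (t n) := div_mul_cancel₀ _ h5.ne'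
    linear_combination (-(gE c (b n) * Real.exp (-x + -(x ^ 2 / (2 * c)) * h n) * w n ^ 2 *
      (b n)⁻¹ ^ 2)) * this
  have X1 : X2 h (fun n => Real.exp (-x + -(x ^ 2 / (2 * c)) * h n)) (Real.exp (-x))
      (Real.exp (-x) * -(x ^ 2 / (2 * c)))
      (Real.exp (-x) * (0 + (-(x ^ 2 / (2 * c))) ^ 2 / 2)) :=
    X2.exp hh ⟨fun _ => 0, tendsto_const_nhds, Eventually.of_forall fun n => by ring⟩
  have Xw : X2 h w 1 (-d) (d ^ 2) := by
    refine ⟨fun n => d ^ 2 * w n, by simpa using hw.const_mul (d ^ 2), ?_⟩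
    filter_upwards [h1dpos] with n hn
    have : w n * (1 + d * h n) = 1 := inv_mul_cancel₀ hn.ne'
    linear_combination (1 - d * h n) * this
  have XJ : X2 h (fun n => J (t n) / J (b n)) 1 0 (2 * β * d) := by
    refine ⟨fun n => (β * d * (w n * (w n + 1)) + (ρ (t n) * w n ^ 4 - ρ (b n))) / J (b n), ?_, ?_⟩
    · have h1 := (((hw.mul (hw.add_const 1)).const_mul (β * d)).add
        (((hρ.comp htt).mul (hw.pow 4)).sub (hρ.comp hbt))).div hJb one_ne_zero
      have e : (β * d * (1 * (1 + 1)) + (γ * 1 ^ 4 - γ)) / 1 = 2 * β * d := by ring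
      rw [e] at h1
      exact h1
    · filter_upwards [hJbpos, hwt, h1dpos] with n h5 h4 hn
      have e : w n * (1 + d * h n) = 1 := inv_mul_cancel₀ hn.ne'
      have e2 : J (t n) = 1 - β * (h n * w n ^ 2) + ρ (t n) * (h n ^ 2 * w n ^ 4) := by
        simp only [hJdef]; rw [h4]; simp only [hhdef]; ring
      have e3 : J (b n) = 1 - β * h n + ρ (b n) * h n ^ 2 := by
        simp only [hJdef, hhdef]; ring
      have e4 : J (t n) = J (b n) + h n ^ 2 *
          (β * d * (w n * (w n + 1)) + (ρ (t n) * w n ^ 4 - ρ (b n))) := by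
        rw [e2, e3]
        linear_combination (-β * h n * (w n + 1)) * e
      rw [e4]
      field_simp
      ring
  have XR0 := ((X1.mul hh (Xw.mul hh Xw)).mul hh XJ)
  have hek : kappaNeg l x = 2⁻¹ * c⁻¹ * (x ^ 2 + 4 * x) * Real.exp (-x) := by rw [hc]; rfl
  have hl0 : l ≠ 0 := hl.ne
  have heo : omegaNeg l x = -(Real.exp (-x) * ((x ^ 4 / 8 + x ^ 3 + 3 * x ^ 2) / c ^ 2 +
      2 * β * d)) := by
    have hl2 : k ^ 2 = l ^ 2 := by rw [hk]; ring
    rw [hd, hβ, hl2]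
    unfold omegaNeg
    rw [← hc]
    field_simp
    rw [hc]
    ring
  have XR : X2 h R (Real.exp (-x)) (-kappaNeg l x) (-omegaNeg l x) := by
    obtain ⟨p, hp, hpe⟩ := XR0
    refine ⟨p, ?_, ?_⟩
    · convert hp using 2
      rw [heo, hd]; field_simp; ring
    · filter_upwards [hpe, hR] with n h1 h2
      rw [h2, h1, hek, hd]; field_simp; ring
  have hRlim : Tendsto R atTop (𝓝 (Real.exp (-x))) := by
    obtain ⟨p, hp, hpe⟩ := XR
    have := ((hh.const_mul (-kappaNeg l x)).const_add (Real.exp (-x))).add ((hh.pow 2).mul hp)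
    simp only [mul_zero, add_zero, ne_eq, OfNat.ofNat_ne_zero, not_false_eq_true, zero_pow,
      zero_mul] at this
    exact this.congr' (hpe.mono fun n hn => hn.symm)
  -- the error in the logarithm
  set y : ℕ → ℝ := fun n => 1 - snCdf l (t n) with hydef
  have hy : Tendsto y atTop (𝓝 0) := by
    simpa using ((snCdf_top l).comp htt).const_sub 1
  have hb4 : Tendsto (fun n => (b n) ^ 4 * (1 - snCdf l (b n))) atTop (𝓝 0) := by
    have h1 := (((gE_sq_tendsto c hcpos).mul hJ).const_mul (π * k * c)⁻¹).comp hbt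
    simp only [zero_mul, mul_zero] at h1
    refine h1.congr' ?_
    filter_upwards [hbpos] with n hn
    have e2 := hT (b n) hn
    change _ = gE c (b n) * (b n)⁻¹ ^ 2 * J (b n) at e2
    have hP : 0 < π * k * c := by positivity
    refine mul_left_cancel₀ hP.ne' ?_
    rw [show π * k * c * (b n ^ 4 * (1 - snCdf l (b n))) =
      b n ^ 4 * (π * k * c * (1 - snCdf l (b n))) by ring, e2]
    simp only [Function.comp]
    field_simp
  have herr : Tendsto (fun n => (b n) ^ 4 * ((n:ℝ) * (Real.log (1 - y n) + y n))) atTop (𝓝 0) := by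
    have h1 : Tendsto (fun n => (b n) ^ 4 * (1 - snCdf l (b n)) * R n ^ 2 * (1 - y n)⁻¹)
        atTop (𝓝 0) := by
      have h2 : Tendsto (fun n => (1 - y n)⁻¹) atTop (𝓝 1) := by
        simpa using (hy.const_sub 1).inv₀ (by norm_num)
      simpa using (hb4.mul (hRlim.pow 2)).mul h2
    refine squeeze_zero_norm' ?_ h1
    filter_upwards [hnT, hy.eventually_lt_const one_pos] with n h6 h7
    rw [Real.norm_eq_abs, abs_mul, abs_mul, abs_of_nonneg (by positivity : 0 ≤ (b n) ^ 4),
      Nat.abs_cast]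
    have h8 := log_bound h7
    have h9 : (b n) ^ 4 * (1 - snCdf l (b n)) * R n ^ 2 * (1 - y n)⁻¹ =
        (b n) ^ 4 * ((n:ℝ) * (y n ^ 2 / (1 - y n))) := by
      have : R n = n * y n := rfl
      rw [this, div_eq_mul_inv]
      linear_combination ((b n) ^ 4 * n * y n ^ 2 * (1 - y n)⁻¹) * h6
    rw [h9]
    gcongr
  have XY : X2 h (fun n => (n:ℝ) * Real.log (1 - y n)) (-Real.exp (-x)) (kappaNeg l x)
      (omegaNeg l x) := by
    obtain ⟨p, hp, hpe⟩ := XR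
    refine ⟨fun n => -p n + (b n) ^ 4 * ((n:ℝ) * (Real.log (1 - y n) + y n)), ?_, ?_⟩
    · simpa using hp.neg.add herr
    · filter_upwards [hpe, hbpos] with n h1 h2
      have h3 : (n:ℝ) * y n = Real.exp (-x) + -kappaNeg l x * h n + h n ^ 2 * p n := h1
      have h4 : h n ^ 2 * (b n) ^ 4 = 1 := by simp only [hhdef]; field_simp
      linear_combination (-1) * h3 - ((n:ℝ) * (Real.log (1 - y n) + y n)) * h4
  obtain ⟨p, hp, hpe⟩ := XY.exp hh
  have hfin : (omegaNeg l x + (kappaNeg l x) ^ 2 / 2) * gumbel x =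
      Real.exp (-Real.exp (-x)) * (omegaNeg l x + (kappaNeg l x) ^ 2 / 2) := by
    unfold gumbel; ring
  rw [hfin]
  refine hp.congr' ?_
  filter_upwards [hpe, hbpos, hy.eventually_lt_const one_pos] with n h1 h2 h3
  have e1 : snCdf l (t n) ^ n = Real.exp (n * Real.log (1 - y n)) := by
    have e : 1 - y n = snCdf l (t n) := by simp only [hydef]; ring
    have hpos : 0 < snCdf l (t n) := by rw [← e]; linarith
    rw [e, ← Real.log_pow, Real.exp_log (pow_pos hpos n)]
  have h4 : h n * (b n) ^ 2 = 1 := by simp only [hhdef]; field_simp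
  change p n = b n ^ 2 * (b n ^ 2 * (snCdf l (t n) ^ n - gumbel x) - kappaNeg l x * gumbel x)
  rw [e1, h1]
  unfold gumbel
  linear_combination (-(b n ^ 2 * kappaNeg l x * Real.exp (-Real.exp (-x))) -
    p n * (h n * b n ^ 2 + 1)) * h4
end
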